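/- arXiv:1108.1910 — 3 statements merged into one kernel-verified Lean document; each statement's English description precedes it below -/
import Mathlib

section
/- For every exercise policy E = (E_t) and every t = 0,…,T, the set E_t equals the union over τ ∈ T^E of the events {τ = t}, and also equals the union over χ ∈ X^E of the events {χ_t > 0}. -/
open Finset MeasureTheory
open scoped Pointwise

namespace RZpaper

/-- Portfolio space `ℝ^d`. -/
abbrev V (d : ℕ) : Type := Fin d → ℝ

/-- Euclidean scalar product on `ℝ^d`. -/
def vdot {d : ℕ} (x y : V d) : ℝ := ∑ j, x j * y j

/-- The `i`-th standard basis vector `e^i` of `ℝ^d`. -/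
def eV {d : ℕ} (i : Fin d) : V d := Pi.single i 1

/-- A probability measure on a finite sample space, given by its weights. -/
structure Prob (Ω : Type*) [Fintype Ω] where
  w : Ω → ℝ
  nonneg : ∀ ω, 0 ≤ w ω
  total : ∑ ω, w ω = 1

/-- `g` is a version of the conditional expectation `E_P(X | m)` on a finite space. -/
def IsCondExp {Ω : Type*} [Fintype Ω] {E : Type*} [AddCommMonoid E] [Module ℝ E]
    [MeasurableSpace E] (P : Prob Ω) (m : MeasurableSpace Ω) (X g : Ω → E) : Prop :=
  Measurable[m] g ∧ ∀ A : Set Ω, MeasurableSet[m] A →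
    (∑ ω, A.indicator (fun ω' => P.w ω' • g ω') ω) =
      ∑ ω, A.indicator (fun ω' => P.w ω' • X ω') ω

/-- The atom (node) of the σ-algebra `m` containing `ω`. -/
def node {Ω : Type*} (m : MeasurableSpace Ω) (ω : Ω) : Set Ω :=
  {ω' | ∀ A : Set Ω, MeasurableSet[m] A → ω ∈ A → ω' ∈ A}

/-- `E*_t := ∪_{s=t}^T E_s`. -/
def EStar {Ω : Type*} (T : ℕ) (E : ℕ → Set Ω) (t : ℕ) : Set Ω :=
  ⋃ s ∈ Finset.Icc t T, E s

/-- `R` is a set of representatives for the atoms of `m` contained in `μ`: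
each point of `μ` belongs to the node of exactly one member of `R`. -/
def Transversal {Ω : Type*} (m : MeasurableSpace Ω) (μ : Set Ω) (R : Finset Ω) : Prop :=
  (∀ r ∈ R, r ∈ μ) ∧ ∀ ω' ∈ μ, ∃! r, r ∈ R ∧ ω' ∈ node m r

/-- Support function `δ*_A : ℝ^d → ℝ ∪ {∞}` of a set `A ⊆ ℝ^d` (with values in `EReal`). -/
noncomputable def sfn {d : ℕ} (A : Set (V d)) (x : V d) : EReal :=
  sSup ((fun y => ((vdot x y : ℝ) : EReal)) '' A)

/-- Effective domain of an `EReal`-valued function. -/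
def edom {d : ℕ} (f : V d → EReal) : Set (V d) := {x | f x ≠ ⊤}

/-- `σ_i(A) := {x ∈ A : x^i = 1}`. -/
def sig {d : ℕ} (i : Fin d) (A : Set (V d)) : Set (V d) := {x ∈ A | x i = 1}

/-- The cone generated by `A`. -/
def cone0 {d : ℕ} (A : Set (V d)) : Set (V d) :=
  {x | ∃ c : ℝ, 0 ≤ c ∧ ∃ y ∈ A, x = c • y}

/-- A cone `C` is compactly `i`-generated if `σ_i(C)` is compact, nonempty
and `C = cone σ_i(C)`. -/
def CompactlyGen {d : ℕ} (i : Fin d) (C : Set (V d)) : Prop :=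
  (sig i C).Nonempty ∧ IsCompact (sig i C) ∧ C = cone0 (sig i C)

/-- A polyhedral cone: nonnegative combinations of finitely many vectors. -/
def IsPolyCone {d : ℕ} (C : Set (V d)) : Prop :=
  ∃ (n : ℕ) (v : Fin n → V d),
    C = {x | ∃ c : Fin n → ℝ, (∀ k, 0 ≤ c k) ∧ x = ∑ k, c k • v k}

/-- Convex hull of two extended-real-valued functions, via the infimum formula. -/
noncomputable def fconv2 {d : ℕ} (g h : V d → EReal) (x : V d) : EReal :=
  sInf {r : EReal | ∃ (a b : ℝ) (xg xh : V d), 0 ≤ a ∧ 0 ≤ b ∧ a + b = 1 ∧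
    a • xg + b • xh = x ∧ r = (a : EReal) * g xg + (b : EReal) * h xh}

/-- Convex hull of a finite family of extended-real-valued functions, via the
infimum formula. -/
noncomputable def fconvF {d : ℕ} {ι : Type*} (s : Finset ι) (g : ι → V d → EReal)
    (x : V d) : EReal :=
  sInf {r : EReal | ∃ (α : ι → ℝ) (p : ι → V d), (∀ k, 0 ≤ α k) ∧ (∑ k ∈ s, α k) = 1 ∧
    (∑ k ∈ s, α k • p k) = x ∧ r = ∑ k ∈ s, ((α k : ℝ) : EReal) * g k (p k)}

/-- The randomised stopping time `χ^τ` associated with an ordinary stopping time `τ`. -/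
def chiOf {Ω : Type*} (τ : Ω → ℕ) : ℕ → Ω → ℝ := fun t ω => if τ ω = t then 1 else 0

/-- Kabanov's currency market model with proportional transaction costs on a finite
probability space: a filtration `F` on time horizon `T` with `F 0` trivial and
`F T = ⊤`, and an adapted matrix-valued exchange rate process `pi` with positive
entries. -/
structure Market (Ω : Type*) [Fintype Ω] (T d : ℕ) where
  F : ℕ → MeasurableSpace Ω
  F_mono : ∀ s t : ℕ, s ≤ t → F s ≤ F t
  F_zero : F 0 = ⊥
  F_top : F T = ⊤
  pi : ℕ → Ω → Fin d → Fin d → ℝ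
  pi_pos : ∀ t, t ≤ T → ∀ ω i j, 0 < pi t ω i j
  pi_adapted : ∀ t, t ≤ T → Measurable[F t] (pi t)

namespace Market

variable {Ω : Type*} [Fintype Ω] {T d : ℕ}

/-- The ω-wise solvency cone `S_t(ω) = L_t^+ − K_t` at time `t`:
portfolios that can be exchanged into a nonnegative portfolio. -/
def solvency (M : Market Ω T d) (t : ℕ) (ω : Ω) : Set (V d) :=
  {x | ∃ β : Fin d → Fin d → ℝ, (∀ i j, 0 ≤ β i j) ∧
    ∀ j, 0 ≤ x j + (∑ i, β i j) - ∑ i, β j i * M.pi t ω j i}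

/-- The ω-wise dual cone `S_t^*(ω)` of the solvency cone. -/
def dualCone (M : Market Ω T d) (t : ℕ) (ω : Ω) : Set (V d) :=
  {y | ∀ x ∈ M.solvency t ω, 0 ≤ vdot y x}

/-- Self-financing (predictable) trading strategies. -/
def SelfFinancing (M : Market Ω T d) (y : ℕ → Ω → V d) : Prop :=
  (∀ t, t ≤ T → Measurable[M.F (t - 1)] (y t)) ∧
  ∀ t, t < T → ∀ ω, y t ω - y (t + 1) ω ∈ M.solvency t ω

/-- The weak no-arbitrage property `(NA^w)`. -/
def WNA (M : Market Ω T d) : Prop :=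
  {z : Ω → V d | ∃ y, M.SelfFinancing y ∧ (∀ ω, y 0 ω = 0) ∧ y T = z} ∩
    {z : Ω → V d | ∀ ω j, 0 ≤ z ω j} = {0}

/-- Adapted `ℝ^d`-valued process. -/
def Adapted (M : Market Ω T d) (ξ : ℕ → Ω → V d) : Prop :=
  ∀ t, t ≤ T → Measurable[M.F t] (ξ t)

/-- Stopping times with values in `{0, …, T}`. -/
def IsStop (M : Market Ω T d) (τ : Ω → ℕ) : Prop :=
  (∀ ω, τ ω ≤ T) ∧ ∀ t : ℕ, MeasurableSet[M.F t] {ω | τ ω = t}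

/-- Randomised stopping times. -/
def IsRStop (M : Market Ω T d) (χ : ℕ → Ω → ℝ) : Prop :=
  (∀ t, t ≤ T → Measurable[M.F t] (χ t)) ∧ (∀ t, t ≤ T → ∀ ω, 0 ≤ χ t ω) ∧
  ∀ ω, ∑ t ∈ Finset.range (T + 1), χ t ω = 1

/-- Exercise policies. -/
def IsPolicy (M : Market Ω T d) (E : ℕ → Set Ω) : Prop :=
  (∀ t, t ≤ T → MeasurableSet[M.F t] (E t)) ∧
  (∀ t, t < T → MeasurableSet[M.F t] (⋃ s ∈ Finset.Icc (t + 1) T, E s)) ∧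
  (⋃ t ∈ Finset.range (T + 1), E t) = Set.univ

/-- Ordinary stopping times consistent with the exercise policy `E`, i.e. `τ ∈ T^E`. -/
def ConsStop (M : Market Ω T d) (E : ℕ → Set Ω) (τ : Ω → ℕ) : Prop :=
  M.IsStop τ ∧ ∀ t : ℕ, {ω | τ ω = t} ⊆ E t

/-- Randomised stopping times consistent with the exercise policy `E`, i.e. `χ ∈ X^E`. -/
def ConsRStop (M : Market Ω T d) (E : ℕ → Set Ω) (χ : ℕ → Ω → ℝ) : Prop :=
  M.IsRStop χ ∧ ∀ t, t ≤ T → {ω | 0 < χ t ω} ⊆ E t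

/-- `ζ` is measurable with respect to the σ-algebra `F_τ` of the stopping time `τ`. -/
def MeasStopped (M : Market Ω T d) (τ : Ω → ℕ) (ζ : Ω → V d) : Prop :=
  ∀ s : Set (V d), MeasurableSet s → ∀ t : ℕ, MeasurableSet[M.F t] (ζ ⁻¹' s ∩ {ω | τ ω = t})

/-- `S^{χ*}_t := ∑_{s=t}^T χ_s S_s` (so `S^{χ*}_{T+1} = 0`). -/
noncomputable def schi (M : Market Ω T d) (χ : ℕ → Ω → ℝ) (S : ℕ → Ω → V d) (t : ℕ) :
    Ω → V d :=
  fun ω => ∑ s ∈ Finset.Icc t T, χ s ω • S s ω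

/-- `(P, S)` is a `χ`-approximate martingale pair: `S_t ∈ S_t^* \ {0}` and
`E_P(S^{χ*}_{t+1} | F_t)` has a version with values in `S_t^*`, for all `t ≤ T`. -/
def ApproxPair (M : Market Ω T d) (χ : ℕ → Ω → ℝ) (P : Prob Ω) (S : ℕ → Ω → V d) : Prop :=
  (∀ t, t ≤ T → Measurable[M.F t] (S t)) ∧
  (∀ t, t ≤ T → ∀ ω, S t ω ∈ M.dualCone t ω ∧ S t ω ≠ 0) ∧
  ∀ t, t ≤ T → ∃ g : Ω → V d, IsCondExp P (M.F t) (M.schi χ S (t + 1)) g ∧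
    ∀ ω, g ω ∈ M.dualCone t ω

/-- Membership of `P̄^i(χ)`: a `χ`-approximate martingale pair with `S^i ≡ 1`. -/
def ApproxPairI (M : Market Ω T d) (i : Fin d) (χ : ℕ → Ω → ℝ) (P : Prob Ω)
    (S : ℕ → Ω → V d) : Prop :=
  M.ApproxPair χ P S ∧ ∀ t, t ≤ T → ∀ ω, S t ω i = 1

/-- Membership of `P^i(χ)`: a `χ`-approximate *equivalent* martingale pair with `S^i ≡ 1`. -/
def EqvApproxPairI (M : Market Ω T d) (i : Fin d) (χ : ℕ → Ω → ℝ) (P : Prob Ω)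
    (S : ℕ → Ω → V d) : Prop :=
  M.ApproxPairI i χ P S ∧ ∀ ω, 0 < P.w ω

/-- Membership of `P̄^i`: `S` is a `P`-martingale with `S_t ∈ S_t^* \ {0}` and `S^i ≡ 1`. -/
def MartPairI (M : Market Ω T d) (i : Fin d) (P : Prob Ω) (S : ℕ → Ω → V d) : Prop :=
  (∀ t, t ≤ T → Measurable[M.F t] (S t)) ∧
  (∀ t, t < T → IsCondExp P (M.F t) (S (t + 1)) (S t)) ∧
  (∀ t, t ≤ T → ∀ ω, S t ω ∈ M.dualCone t ω ∧ S t ω ≠ 0) ∧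
  (∀ t, t ≤ T → ∀ ω, S t ω i = 1)

/-- `E_P((ξ·S)_χ)`. -/
noncomputable def expVal (M : Market Ω T d) (P : Prob Ω) (ξ S : ℕ → Ω → V d)
    (χ : ℕ → Ω → ℝ) : ℝ :=
  ∑ ω, P.w ω * ∑ t ∈ Finset.range (T + 1), χ t ω * vdot (ξ t ω) (S t ω)

/-- The covering condition for the seller: `y_τ − ξ_τ ∈ S_τ` for all `τ ∈ T^E`. -/
def SellerCovers (M : Market Ω T d) (E : ℕ → Set Ω) (ξ y : ℕ → Ω → V d) : Prop :=
  ∀ τ : Ω → ℕ, M.ConsStop E τ → ∀ ω, y (τ ω) ω - ξ (τ ω) ω ∈ M.solvency (τ ω) ω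

/-- `y` superhedges the option `(ξ, E)` for the seller. -/
def SellerHedge (M : Market Ω T d) (E : ℕ → Set Ω) (ξ y : ℕ → Ω → V d) : Prop :=
  M.SelfFinancing y ∧ M.SellerCovers E ξ y

/-- The ask (seller's) price of `(ξ, E)` in currency `i`. -/
noncomputable def ask (M : Market Ω T d) (E : ℕ → Set Ω) (ξ : ℕ → Ω → V d) (i : Fin d) : ℝ :=
  sInf {x : ℝ | ∃ y, M.SellerHedge E ξ y ∧ ∀ ω, y 0 ω = x • eV i}

/-- The covering condition for the buyer: `y_τ + ξ_τ ∈ S_τ`. -/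
def BuyerCovers (M : Market Ω T d) (ξ y : ℕ → Ω → V d) (τ : Ω → ℕ) : Prop :=
  ∀ ω, y (τ ω) ω + ξ (τ ω) ω ∈ M.solvency (τ ω) ω

/-- `(y, τ)` superhedges the option `(ξ, E)` for the buyer. -/
def BuyerHedge (M : Market Ω T d) (E : ℕ → Set Ω) (ξ y : ℕ → Ω → V d) (τ : Ω → ℕ) : Prop :=
  M.SelfFinancing y ∧ M.ConsStop E τ ∧ M.BuyerCovers ξ y τ

/-- The bid (buyer's) price of `(ξ, E)` in currency `i`. -/
noncomputable def bid (M : Market Ω T d) (E : ℕ → Set Ω) (ξ : ℕ → Ω → V d) (i : Fin d) : ℝ :=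
  sSup {r : ℝ | ∃ y τ, M.BuyerHedge E ξ y τ ∧ ∀ ω, y 0 ω = (-r) • eV i}

open scoped Classical in
/-- `U^a_t := ξ_t + S_t` on `E_t`, `ℝ^d` off `E_t` (ω-wise). -/
noncomputable def Ua (M : Market Ω T d) (E : ℕ → Set Ω) (ξ : ℕ → Ω → V d) (t : ℕ) (ω : Ω) :
    Set (V d) :=
  if ω ∈ E t then {ξ t ω} + M.solvency t ω else Set.univ

/-- Backward recursion for the seller's construction, indexed by `k = T − t`. -/
noncomputable def ZaAux (M : Market Ω T d) (E : ℕ → Set Ω) (ξ : ℕ → Ω → V d) :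
    ℕ → Ω → Set (V d)
  | 0 => M.Ua E ξ T
  | (k + 1) => fun ω =>
      M.Ua E ξ (T - (k + 1)) ω ∩
        ({v | ∀ ω' ∈ node (M.F (T - (k + 1))) ω, v ∈ M.ZaAux E ξ k ω'} +
          M.solvency (T - (k + 1)) ω)

/-- The seller's sets `Z^a_t` (ω-wise), via Construction A. -/
noncomputable def Za (M : Market Ω T d) (E : ℕ → Set Ω) (ξ : ℕ → Ω → V d) (t : ℕ) :
    Ω → Set (V d) := M.ZaAux E ξ (T - t)

open scoped Classical in
/-- The seller's sets `W^a_t = Z^a_{t+1} ∩ L_t` (ω-wise), with `W^a_T = L_T`. -/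
noncomputable def Wa (M : Market Ω T d) (E : ℕ → Set Ω) (ξ : ℕ → Ω → V d) (t : ℕ) (ω : Ω) :
    Set (V d) :=
  if t < T then {v | ∀ ω' ∈ node (M.F t) ω, v ∈ M.Za E ξ (t + 1) ω'} else Set.univ

open scoped Classical in
/-- The seller's sets `V^a_t = W^a_t + S_t` (ω-wise), with `V^a_T = L_T`. -/
noncomputable def Va (M : Market Ω T d) (E : ℕ → Set Ω) (ξ : ℕ → Ω → V d) (t : ℕ) (ω : Ω) :
    Set (V d) :=
  if t < T then M.Wa E ξ t ω + M.solvency t ω else Set.univ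

/-- `Z^a_0` as a subset of `ℝ^d` (recall `F_0` is trivial). -/
noncomputable def Za0 (M : Market Ω T d) (E : ℕ → Set Ω) (ξ : ℕ → Ω → V d) : Set (V d) :=
  {v | ∀ ω, v ∈ M.Za E ξ 0 ω}

open scoped Classical in
/-- `U^b_t := −ξ_t + S_t` on `E_t`, `∅` off `E_t` (ω-wise). -/
noncomputable def Ub (M : Market Ω T d) (E : ℕ → Set Ω) (ξ : ℕ → Ω → V d) (t : ℕ) (ω : Ω) :
    Set (V d) :=
  if ω ∈ E t then {-(ξ t ω)} + M.solvency t ω else ∅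

/-- Backward recursion for the buyer's construction, indexed by `k = T − t`. -/
noncomputable def ZbAux (M : Market Ω T d) (E : ℕ → Set Ω) (ξ : ℕ → Ω → V d) :
    ℕ → Ω → Set (V d)
  | 0 => M.Ub E ξ T
  | (k + 1) => fun ω =>
      M.Ub E ξ (T - (k + 1)) ω ∪
        ({v | ∀ ω' ∈ node (M.F (T - (k + 1))) ω, v ∈ M.ZbAux E ξ k ω'} +
          M.solvency (T - (k + 1)) ω)

/-- The buyer's sets `Z^b_t` (ω-wise), via Construction B. -/
noncomputable def Zb (M : Market Ω T d) (E : ℕ → Set Ω) (ξ : ℕ → Ω → V d) (t : ℕ) :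
    Ω → Set (V d) := M.ZbAux E ξ (T - t)

/-- `Z^b_0` as a subset of `ℝ^d` (recall `F_0` is trivial). -/
noncomputable def Zb0 (M : Market Ω T d) (E : ℕ → Set Ω) (ξ : ℕ → Ω → V d) : Set (V d) :=
  {v | ∀ ω, v ∈ M.Zb E ξ 0 ω}

end Market

namespace Market

variable {Ω : Type*} {T d : ℕ}

open scoped Classical in
/-- The last time `s ≤ T` with `ω ∈ E s` (and `0` if there is none). -/
noncomputable def lastTime (T : ℕ) (E : ℕ → Set Ω) (ω : Ω) : ℕ :=
  Nat.findGreatest (fun s => ω ∈ E s) T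

lemma mem_lastTime [Fintype Ω] {M : Market Ω T d} {E : ℕ → Set Ω} (hE : M.IsPolicy E)
    (ω : Ω) :
    ω ∈ E (lastTime T E ω) := by
  classical
  have h : ω ∈ ⋃ t ∈ Finset.range (T + 1), E t := hE.2.2 ▸ Set.mem_univ ω
  obtain ⟨s, hs, hω⟩ := Set.mem_iUnion₂.mp h
  exact Nat.findGreatest_spec (P := fun s => ω ∈ E s)
    (Nat.lt_succ_iff.mp (Finset.mem_range.mp hs)) hω

lemma lastTime_le (E : ℕ → Set Ω) (ω : Ω) : lastTime T E ω ≤ T := by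
  classical
  exact Nat.findGreatest_le T

lemma le_lastTime {E : ℕ → Set Ω} {ω : Ω} {s : ℕ} (hs : s ≤ T) (hω : ω ∈ E s) :
    s ≤ lastTime T E ω := by
  classical
  exact Nat.le_findGreatest hs hω

lemma measurableSet_lastTime_eq [Fintype Ω] {M : Market Ω T d} {E : ℕ → Set Ω}
    (hE : M.IsPolicy E) {s : ℕ} (hs : s ≤ T) : MeasurableSet[M.F s] {ω | lastTime T E ω = s} := by
  have hset : {ω | lastTime T E ω = s} = E s \ ⋃ u ∈ Finset.Icc (s + 1) T, E u := by
    ext ω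
    simp only [Set.mem_ofPred_eq, Set.mem_sdiff, Set.mem_iUnion, Finset.mem_Icc, not_exists]
    constructor
    · rintro rfl
      refine ⟨mem_lastTime hE ω, fun u hu hω => ?_⟩
      have := le_lastTime hu.2 hω
      omega
    · rintro ⟨hω, hlast⟩
      refine le_antisymm ?_ (le_lastTime hs hω)
      by_contra! hlt
      exact hlast _ ⟨hlt, lastTime_le E ω⟩ (mem_lastTime hE ω)
  rw [hset]
  refine (hE.1 s hs).diff ?_
  rcases hs.lt_or_eq with hlt | rfl
  · exact hE.2.1 s hlt
  · simp

open scoped Classical in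
/-- The rule that exercises at time `t` on `E t`, and at the last possible time elsewhere. -/
noncomputable def exerciseAt (T : ℕ) (E : ℕ → Set Ω) (t : ℕ) (ω : Ω) : ℕ :=
  if ω ∈ E t then t else lastTime T E ω

lemma exerciseAt_of_mem {E : ℕ → Set Ω} {t : ℕ} {ω : Ω} (hω : ω ∈ E t) :
    exerciseAt T E t ω = t := if_pos hω

lemma exerciseAt_of_notMem {E : ℕ → Set Ω} {t : ℕ} {ω : Ω} (hω : ω ∉ E t) :
    exerciseAt T E t ω = lastTime T E ω := if_neg hω

lemma consStop_exerciseAt [Fintype Ω] {M : Market Ω T d} {E : ℕ → Set Ω}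
    (hE : M.IsPolicy E) {t : ℕ} (ht : t ≤ T) : M.ConsStop E (exerciseAt T E t) := by
  have hle : ∀ ω, exerciseAt T E t ω ≤ T := fun ω => by
    by_cases hω : ω ∈ E t
    · rwa [exerciseAt_of_mem hω]
    · rw [exerciseAt_of_notMem hω]
      exact lastTime_le E ω
  have hmem : ∀ ω, ω ∈ E (exerciseAt T E t ω) := fun ω => by
    by_cases hω : ω ∈ E t
    · rwa [exerciseAt_of_mem hω]
    · rw [exerciseAt_of_notMem hω]
      exact mem_lastTime hE ω
  refine ⟨⟨hle, fun s => ?_⟩, fun s ω hω => hω ▸ hmem ω⟩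
  rcases lt_or_ge T s with hs | hs
  · convert @MeasurableSet.empty Ω (M.F s) using 1
    exact Set.eq_empty_of_forall_notMem fun ω hω => absurd (hω ▸ hle ω) hs.not_ge
  rcases lt_trichotomy s t with hst | rfl | hts
  · convert measurableSet_lastTime_eq hE hs using 1
    ext ω
    by_cases hω : ω ∈ E t
    · have := le_lastTime ht hω
      simp only [Set.mem_ofPred_eq, exerciseAt_of_mem hω]
      omega
    · simp only [Set.mem_ofPred_eq, exerciseAt_of_notMem hω]
  · convert hE.1 s hs using 1
    ext ω
    exact ⟨fun hω => hω ▸ hmem ω, exerciseAt_of_mem⟩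
  · convert (measurableSet_lastTime_eq hE hs).diff (M.F_mono t s hts.le _ (hE.1 t ht)) using 1
    ext ω
    by_cases hω : ω ∈ E t
    · simp [exerciseAt_of_mem hω, hω, hts.ne]
    · simp [exerciseAt_of_notMem hω, hω]

lemma ConsStop.consRStop_chiOf [Fintype Ω] {M : Market Ω T d} {E : ℕ → Set Ω}
    {τ : Ω → ℕ} (hτ : M.ConsStop E τ) : M.ConsRStop E (chiOf τ) := by
  refine ⟨⟨fun s _ => ?_, fun s _ ω => ?_, fun ω => ?_⟩, fun s _ ω hω => hτ.2 s ?_⟩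
  · exact Measurable.ite (hτ.1.2 s) measurable_const measurable_const
  · unfold chiOf
    positivity
  · simp only [chiOf, Finset.sum_ite_eq, Finset.mem_range]
    exact if_pos (Nat.lt_succ_of_le (hτ.1.1 ω))
  · by_contra hne
    have hzero : chiOf τ s ω = 0 := if_neg hne
    exact lt_irrefl (0 : ℝ) (hzero ▸ hω)

end Market

/-- for every exercise policy `E` and every `t ≤ T`, the set `E_t` is the
union over `τ ∈ T^E` of `{τ = t}`, and also the union over `χ ∈ X^E` of `{χ_t > 0}`. -/
theorem statement2 {Ω : Type*} [Fintype Ω] [Nonempty Ω] {T d : ℕ}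
    (M : Market Ω T d) (E : ℕ → Set Ω) (hE : M.IsPolicy E) :
    ∀ t, t ≤ T →
      E t = {ω | ∃ τ : Ω → ℕ, M.ConsStop E τ ∧ τ ω = t} ∧
      E t = {ω | ∃ χ : ℕ → Ω → ℝ, M.ConsRStop E χ ∧ 0 < χ t ω} := by
  intro t ht
  have hτ := Market.consStop_exerciseAt hE ht
  refine ⟨Set.Subset.antisymm ?_ ?_, Set.Subset.antisymm ?_ ?_⟩
  · exact fun ω hω => ⟨_, hτ, Market.exerciseAt_of_mem hω⟩
  · rintro ω ⟨τ, hτE, hω⟩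
    exact hτE.2 t hω
  · refine fun ω hω => ⟨_, hτ.consRStop_chiOf, ?_⟩
    simp [chiOf, Market.exerciseAt_of_mem hω]
  · rintro ω ⟨χ, hχ, hω⟩
    exact hχ.2 t ht hω

end RZpaper
end

section
/- Assume the model satisfies the weak no-arbitrage property and let (ξ, E) be an option. For every t, every node μ ∈ Ω_t and every y ∈ ℝ^d: the support function U^{aμ}_t of −U^{aμ}_t satisfies U^{aμ}_t(y) = −y·ξ^μ_t if μ ⊆ E_t and y ∈ S_t^{*μ}; U^{aμ}_t(y) = 0 if μ ⊆ Ω ∖ E_t and y = 0; and U^{aμ}_t(y) = ∞ if y ∉ S_t^{*μ}, or if μ ⊆ Ω ∖ E_t and y ≠ 0. Moreover, for t ≤ T, the support functions V^{aμ}_t of −V^{aμ}_t and W^{aμ}_t of −W^{aμ}_t satisfy V^{aμ}_t(y) = W^{aμ}_t(y) if y ∈ S_t^{*μ} and V^{aμ}_t(y) = ∞ otherwise. -/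
open Finset MeasureTheory
open scoped Pointwise

namespace RZpaper

theorem vdot_add {d : ℕ} (x y z : V d) : vdot x (y + z) = vdot x y + vdot x z :=
  dotProduct_add x y z

theorem vdot_neg {d : ℕ} (x y : V d) : vdot x (-y) = -vdot x y :=
  dotProduct_neg x y

theorem vdot_smul {d : ℕ} (x : V d) (r : ℝ) (y : V d) : vdot x (r • y) = r * vdot x y :=
  dotProduct_smul r x y

theorem vdot_zero_left {d : ℕ} (x : V d) : vdot 0 x = 0 :=
  zero_dotProduct x

theorem vdot_self_pos {d : ℕ} {y : V d} (hy : y ≠ 0) : 0 < vdot y y :=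
  (Finset.sum_nonneg fun j _ => mul_self_nonneg (y j)).lt_of_ne
    fun h => hy (dotProduct_self_eq_zero.1 h.symm)

theorem le_sfn_neg {d : ℕ} {A : Set (V d)} {y a : V d} (ha : a ∈ A) :
    ((-(vdot y a) : ℝ) : EReal) ≤ sfn (-A) y :=
  le_sSup ⟨-a, by simpa using ha, by simp only [vdot_neg]⟩

theorem sfn_neg_le {d : ℕ} {A : Set (V d)} {y : V d} {c : EReal}
    (h : ∀ a ∈ A, ((-(vdot y a) : ℝ) : EReal) ≤ c) : sfn (-A) y ≤ c := by
  refine sSup_le ?_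
  rintro _ ⟨b, hb, rfl⟩
  simpa [vdot_neg] using h (-b) hb

/-- The support function of `-A` is infinite in every direction in which `A` contains a
descending ray. -/
theorem sfn_neg_eq_top {d : ℕ} {A : Set (V d)} {y a x : V d}
    (h : ∀ r : ℝ, 0 ≤ r → a + r • x ∈ A) (hx : vdot y x < 0) : sfn (-A) y = ⊤ := by
  refine (EReal.eq_top_iff_forall_lt _).2 fun c => ?_
  obtain ⟨n, hn⟩ := exists_nat_gt ((c + vdot y a) / -vdot y x)
  refine lt_of_lt_of_le ?_ (le_sfn_neg (h n n.cast_nonneg))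
  rw [div_lt_iff₀ (neg_pos.2 hx)] at hn
  rw [EReal.coe_lt_coe_iff, vdot_add, vdot_smul]
  linarith

/-- Adding a set `S ∋ 0` on which `y` is nonnegative leaves the support function at `y`
unchanged. -/
theorem sfn_neg_add_of_nonneg {d : ℕ} {A S : Set (V d)} {y : V d} (h0 : 0 ∈ S)
    (hy : ∀ x ∈ S, 0 ≤ vdot y x) : sfn (-(A + S)) y = sfn (-A) y := by
  apply le_antisymm
  · refine sfn_neg_le ?_
    rintro _ ⟨a, ha, s, hs, rfl⟩
    refine le_trans ?_ (le_sfn_neg ha)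
    rw [EReal.coe_le_coe_iff, vdot_add]
    linarith [hy s hs]
  · exact sfn_neg_le fun a ha => le_sfn_neg ⟨a, ha, 0, h0, add_zero a⟩

theorem sfn_neg_singleton {d : ℕ} (a y : V d) :
    sfn (-{a}) y = ((-(vdot y a) : ℝ) : EReal) :=
  le_antisymm (sfn_neg_le fun b hb => by rw [Set.mem_singleton_iff.1 hb]) (le_sfn_neg rfl)

namespace Market

variable {Ω : Type*} [Fintype Ω] {T d : ℕ}

theorem mem_solvency_of_nonneg (M : Market Ω T d) (t : ℕ) (ω : Ω) {x : V d}
    (hx : ∀ j, 0 ≤ x j) : x ∈ M.solvency t ω :=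
  ⟨0, fun _ _ => le_rfl, fun j => by simpa using hx j⟩

theorem zero_mem_solvency (M : Market Ω T d) (t : ℕ) (ω : Ω) : 0 ∈ M.solvency t ω :=
  M.mem_solvency_of_nonneg t ω fun _ => le_rfl

theorem smul_mem_solvency (M : Market Ω T d) {t : ℕ} {ω : Ω} {x : V d}
    (hx : x ∈ M.solvency t ω) {r : ℝ} (hr : 0 ≤ r) : r • x ∈ M.solvency t ω := by
  obtain ⟨β, hβ, h⟩ := hx
  refine ⟨fun i j => r * β i j, fun i j => mul_nonneg hr (hβ i j), fun j => ?_⟩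
  have := mul_nonneg hr (h j)
  simpa only [Pi.smul_apply, smul_eq_mul, mul_assoc, ← Finset.mul_sum, ← mul_add, ← mul_sub]
    using this

theorem zero_mem_dualCone (M : Market Ω T d) (t : ℕ) (ω : Ω) : 0 ∈ M.dualCone t ω :=
  fun x _ => (vdot_zero_left x).ge

theorem sfn_neg_add_solvency_eq_top (M : Market Ω T d) {t : ℕ} {ω : Ω} {A : Set (V d)}
    (hA : A.Nonempty) {y : V d} (hy : y ∉ M.dualCone t ω) :
    sfn (-(A + M.solvency t ω)) y = ⊤ := by
  obtain ⟨a, ha⟩ := hA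
  simp only [dualCone, Set.mem_ofPred_eq, not_forall, not_le] at hy
  obtain ⟨x, hx, hlt⟩ := hy
  exact sfn_neg_eq_top (fun r hr => Set.add_mem_add ha (M.smul_mem_solvency hx hr)) hlt

theorem mem_Ua_of_le (M : Market Ω T d) (E : ℕ → Set Ω) {ξ : ℕ → Ω → V d} {t : ℕ} {ω : Ω}
    {v : V d} (hv : ξ t ω ≤ v) : v ∈ M.Ua E ξ t ω := by
  unfold Ua
  split_ifs
  · exact ⟨ξ t ω, rfl, v - ξ t ω,
      M.mem_solvency_of_nonneg t ω fun j => sub_nonneg.2 (hv j), add_sub_cancel _ _⟩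
  · trivial

/-- A portfolio dominating every payoff belongs to all the seller's sets. -/
theorem mem_ZaAux_of_le (M : Market Ω T d) (E : ℕ → Set Ω) {ξ : ℕ → Ω → V d} {v : V d}
    (hv : ∀ t ≤ T, ∀ ω, ξ t ω ≤ v) (k : ℕ) (ω : Ω) : v ∈ M.ZaAux E ξ k ω := by
  induction k generalizing ω with
  | zero => exact M.mem_Ua_of_le E (hv T le_rfl ω)
  | succ k ih =>
    exact ⟨M.mem_Ua_of_le E (hv _ (Nat.sub_le _ _) ω), v, fun ω' _ => ih ω', 0,
      M.zero_mem_solvency _ ω, add_zero v⟩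

theorem exists_payoff_bound (T : ℕ) (ξ : ℕ → Ω → V d) :
    ∃ v : V d, ∀ t ≤ T, ∀ ω, ξ t ω ≤ v := by
  have hfin : (Set.range fun p : Fin (T + 1) × Ω => ξ p.1 p.2).Finite := Set.finite_range _
  obtain ⟨v, hv⟩ := hfin.bddAbove
  exact ⟨v, fun t ht ω => hv ⟨(⟨t, Nat.lt_succ_of_le ht⟩, ω), rfl⟩⟩

theorem Wa_nonempty (M : Market Ω T d) (E : ℕ → Set Ω) (ξ : ℕ → Ω → V d) (t : ℕ) (ω : Ω) :
    (M.Wa E ξ t ω).Nonempty := by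
  obtain ⟨v, hv⟩ := exists_payoff_bound T ξ
  refine ⟨v, ?_⟩
  unfold Wa
  split_ifs
  · exact fun ω' _ => M.mem_ZaAux_of_le E hv _ ω'
  · trivial

end Market

theorem sfn_neg_univ_eq_top {d : ℕ} {y : V d} (hy : y ≠ 0) :
    sfn (-(Set.univ : Set (V d))) y = ⊤ :=
  sfn_neg_eq_top (a := 0) (x := -y) (fun _ _ => trivial)
    (by rw [vdot_neg]; exact neg_lt_zero.2 (vdot_self_pos hy))

/-- explicit formulas for the support functions of `−U^a_t`, `−V^a_t`,
`−W^a_t` at each node (represented by any scenario `ω`, the node value being the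
value at `ω`). -/
theorem statement9 {Ω : Type*} [Fintype Ω] [Nonempty Ω] {T d : ℕ}
    (M : Market Ω T d) (hNA : M.WNA) (E : ℕ → Set Ω) (hE : M.IsPolicy E)
    (ξ : ℕ → Ω → V d) (hξ : M.Adapted ξ) :
    ∀ t, t ≤ T → ∀ ω : Ω, ∀ y : V d,
      (ω ∈ E t → y ∈ M.dualCone t ω →
        sfn (-(M.Ua E ξ t ω)) y = ((-(vdot y (ξ t ω)) : ℝ) : EReal)) ∧
      (ω ∉ E t → y = 0 → sfn (-(M.Ua E ξ t ω)) y = 0) ∧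
      ((y ∉ M.dualCone t ω ∨ (ω ∉ E t ∧ y ≠ 0)) → sfn (-(M.Ua E ξ t ω)) y = ⊤) ∧
      (y ∈ M.dualCone t ω → sfn (-(M.Va E ξ t ω)) y = sfn (-(M.Wa E ξ t ω)) y) ∧
      (y ∉ M.dualCone t ω → sfn (-(M.Va E ξ t ω)) y = ⊤) := by
  intro t ht ω y
  have hne : y ∉ M.dualCone t ω → y ≠ 0 := by
    rintro h rfl
    exact h (M.zero_mem_dualCone t ω)
  refine ⟨fun hω hy => ?_, ?_, fun h => ?_, fun hy => ?_, fun hy => ?_⟩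
  · rw [Market.Ua, if_pos hω, sfn_neg_add_of_nonneg (M.zero_mem_solvency t ω) hy,
      sfn_neg_singleton]
  · rintro hω rfl
    rw [Market.Ua, if_neg hω]
    apply le_antisymm
    · exact sfn_neg_le fun a _ => by simp [vdot_zero_left]
    · simpa [vdot_zero_left] using
        le_sfn_neg (A := Set.univ) (y := (0 : V d)) (a := 0) trivial
  · by_cases hω : ω ∈ E t
    · rw [Market.Ua, if_pos hω]
      exact M.sfn_neg_add_solvency_eq_top (Set.singleton_nonempty _)
        (h.resolve_right fun h' => h'.1 hω)
    · rw [Market.Ua, if_neg hω]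
      exact sfn_neg_univ_eq_top (h.elim hne And.right)
  · by_cases htT : t < T
    · rw [Market.Va, if_pos htT, sfn_neg_add_of_nonneg (M.zero_mem_solvency t ω) hy]
    · rw [Market.Va, Market.Wa, if_neg htT, if_neg htT]
  · by_cases htT : t < T
    · rw [Market.Va, if_pos htT]
      exact M.sfn_neg_add_solvency_eq_top (M.Wa_nonempty E ξ t ω) hy
    · rw [Market.Va, if_neg htT]
      exact sfn_neg_univ_eq_top (hne hy)

end RZpaper
end

section
/- Let (ξ, E) be an option, let χ ∈ X^E be a randomised stopping time consistent with E, let (P, S) be a χ-approximate martingale pair, and let y ∈ Φ superhedge (ξ, E) for the seller. Then for every t = 0,…,T, y_t · E_P(S^{χ*}_t | F_t) ≥ E_P((ξ·S)^{χ*}_t | F_t), where (ξ·S)_s := ξ_s·S_s. -/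
open Finset MeasureTheory
open scoped Pointwise

namespace RZpaper

theorem vdot_smul_right {d : ℕ} (x z : V d) (c : ℝ) : vdot x (c • z) = c * vdot x z := by
  simp only [vdot, Pi.smul_apply, smul_eq_mul, Finset.mul_sum]
  exact Finset.sum_congr rfl fun _ _ => by ring

theorem vdot_add_right {d : ℕ} (x z z' : V d) : vdot x (z + z') = vdot x z + vdot x z' := by
  simp [vdot, mul_add, Finset.sum_add_distrib]

theorem vdot_sub_right {d : ℕ} (x z z' : V d) : vdot x (z - z') = vdot x z - vdot x z' := by
  simp [vdot, mul_sub, Finset.sum_sub_distrib]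

theorem vdot_comm {d : ℕ} (x z : V d) : vdot x z = vdot z x := by
  simp [vdot, mul_comm]

theorem vdot_sum_right {d : ℕ} {ι : Type*} (s : Finset ι) (x : V d) (f : ι → V d) :
    vdot x (∑ i ∈ s, f i) = ∑ i ∈ s, vdot x (f i) := by
  simp only [vdot, Finset.sum_apply, Finset.mul_sum]
  exact Finset.sum_comm

theorem measurable_vdot {Ω : Type*} {d : ℕ} {m : MeasurableSpace Ω} {f g : Ω → V d}
    (hf : Measurable[m] f) (hg : Measurable[m] g) : Measurable[m] fun ω => vdot (f ω) (g ω) :=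
  Finset.measurable_fun_sum _ fun j _ =>
    ((measurable_pi_apply j).comp hf).mul ((measurable_pi_apply j).comp hg)

section CondExp

variable {Ω : Type*} [Fintype Ω] {d : ℕ} {P : Prob Ω} {m : MeasurableSpace Ω}

/-- Conditional expectations of real random variables exist on a finite probability space. -/
theorem exists_isCondExp (P : Prob Ω) (m : MeasurableSpace Ω) (X : Ω → ℝ) :
    ∃ g : Ω → ℝ, IsCondExp P m X g := by
  let m0 : MeasurableSpace Ω := ⊤
  let μ : Measure[m0] Ω := ∑ ω, ENNReal.ofReal (P.w ω) • Measure.dirac ω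
  have hm : m ≤ m0 := le_top
  have : IsFiniteMeasure μ := ⟨by
    simp only [μ, Measure.finsetSum_apply, Measure.smul_apply, smul_eq_mul]
    exact ENNReal.sum_lt_top.2 fun ω _ => by simp⟩
  have hμ : ∀ ω, μ.real {ω} = P.w ω := fun ω => by
    classical
    simp [μ, Measure.real, Measure.finsetSum_apply, Set.indicator_apply, P.nonneg]
  have hint : ∀ f : Ω → ℝ, Integrable f μ := fun f => Integrable.of_finite
  have hsum : ∀ (f : Ω → ℝ) (A : Set Ω),
      ∫ ω in A, f ω ∂μ = ∑ ω, A.indicator (fun ω' => P.w ω' • f ω') ω := fun f A => by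
    rw [← integral_indicator (MeasurableSpace.measurableSet_top), integral_fintype (hint _)]
    refine Finset.sum_congr rfl fun ω _ => ?_
    by_cases hω : ω ∈ A <;> simp [hω, hμ]
  refine ⟨μ[X|m], stronglyMeasurable_condExp.measurable, fun A hA => ?_⟩
  rw [← hsum, ← hsum]
  exact setIntegral_condExp hm (hint X) hA

/-- If `X` has smaller integrals than `Y` over all events of `m`, then every version of the
conditional expectation of `Y` dominates some version of that of `X` pointwise. -/
theorem IsCondExp.exists_le {X Y f : Ω → ℝ} (hf : IsCondExp P m Y f)
    (hXY : ∀ A : Set Ω, MeasurableSet[m] A →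
      ∑ ω, A.indicator (fun ω' => P.w ω' • X ω') ω ≤
        ∑ ω, A.indicator (fun ω' => P.w ω' • Y ω') ω) :
    ∃ h : Ω → ℝ, IsCondExp P m X h ∧ ∀ ω, h ω ≤ f ω := by
  obtain ⟨k, hk, hkX⟩ := exists_isCondExp P m X
  have hB : MeasurableSet[m] {ω | f ω < k ω} := measurableSet_lt hf.1 hk
  have hle : ∑ ω, {ω | f ω < k ω}.indicator (fun ω' => P.w ω' * (k ω' - f ω')) ω ≤ 0 := by
    have h := hXY _ hB
    rw [← hkX _ hB, ← hf.2 _ hB, ← sub_nonpos, ← Finset.sum_sub_distrib] at h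
    refine le_of_eq_of_le (Finset.sum_congr rfl fun ω _ => ?_) h
    by_cases hω : f ω < k ω <;> simp [hω, mul_sub]
  have hnn : ∀ ω ∈ (Finset.univ : Finset Ω),
      0 ≤ {ω | f ω < k ω}.indicator (fun ω' => P.w ω' * (k ω' - f ω')) ω := fun ω _ =>
    Set.indicator_nonneg (fun ω' hω' => mul_nonneg (P.nonneg _) (sub_nonneg.2 (le_of_lt hω'))) ω
  have hzero := (Finset.sum_eq_zero_iff_of_nonneg hnn).1 (le_antisymm hle (Finset.sum_nonneg hnn))
  have hmin : ∀ ω, P.w ω • min (k ω) (f ω) = P.w ω • k ω := fun ω => by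
    rcases le_or_gt (k ω) (f ω) with h | h
    · rw [min_eq_left h]
    · have h0 := hzero ω (Finset.mem_univ _)
      rw [Set.indicator_of_mem (show ω ∈ {ω | f ω < k ω} from h), mul_sub] at h0
      rw [min_eq_right h.le, smul_eq_mul, smul_eq_mul]
      linarith
  refine ⟨fun ω => min (k ω) (f ω), ⟨hk.min hf.1, fun A hA => ?_⟩, fun ω => min_le_right _ _⟩
  simp only [hmin]
  exact hkX A hA

/-- Taking out what is known, for the scalar product. -/
theorem IsCondExp.vdot_left {f X g : Ω → V d} (hg : IsCondExp P m X g) (hf : Measurable[m] f) :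
    IsCondExp P m (fun ω => vdot (f ω) (X ω)) (fun ω => vdot (f ω) (g ω)) := by
  classical
  refine ⟨measurable_vdot hf hg.1, fun A hA => ?_⟩
  have key : ∀ Z : Ω → V d, ∑ ω, A.indicator (fun ω' => P.w ω' • vdot (f ω') (Z ω')) ω =
      ∑ c ∈ Finset.univ.image f,
        vdot c (∑ ω, (A ∩ f ⁻¹' {c}).indicator (fun ω' => P.w ω' • Z ω') ω) := fun Z => by
    simp only [vdot_sum_right]
    rw [Finset.sum_comm]
    refine Finset.sum_congr rfl fun ω _ => ?_
    rw [Finset.sum_eq_single (f ω)]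
    · by_cases hω : ω ∈ A
      · simp [hω, vdot_smul_right]
      · simp [hω, vdot]
    · intro c _ hc
      rw [Set.indicator_of_notMem fun h => hc h.2.symm]
      simp [vdot]
    · exact fun h => absurd (Finset.mem_image_of_mem f (Finset.mem_univ ω)) h
  rw [key, key]
  refine Finset.sum_congr rfl fun c _ => ?_
  rw [hg.2 _ (hA.inter (hf (measurableSet_singleton c)))]

theorem IsCondExp.add_left {f X g : Ω → V d} (hg : IsCondExp P m X g) (hf : Measurable[m] f) :
    IsCondExp P m (fun ω => f ω + X ω) (fun ω => f ω + g ω) := by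
  refine ⟨hf.add hg.1, fun A hA => ?_⟩
  have h : ∀ Z : Ω → V d, ∑ ω, A.indicator (fun ω' => P.w ω' • (f ω' + Z ω')) ω =
      ∑ ω, A.indicator (fun ω' => P.w ω' • f ω') ω +
        ∑ ω, A.indicator (fun ω' => P.w ω' • Z ω') ω := fun Z => by
    rw [← Finset.sum_add_distrib]
    refine Finset.sum_congr rfl fun ω _ => ?_
    by_cases hω : ω ∈ A <;> simp [hω]
  rw [h, h, hg.2 A hA]

theorem sum_indicator_weight_mono (P : Prob Ω) (A : Set Ω) {X Y : Ω → ℝ} (h : ∀ ω, X ω ≤ Y ω) :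
    ∑ ω, A.indicator (fun ω' => P.w ω' • X ω') ω ≤
      ∑ ω, A.indicator (fun ω' => P.w ω' • Y ω') ω :=
  Finset.sum_le_sum fun ω _ =>
    Set.indicator_le_indicator (mul_le_mul_of_nonneg_left (h ω) (P.nonneg ω))

theorem sum_indicator_weight_add (P : Prob Ω) (A : Set Ω) (X Y : Ω → ℝ) :
    ∑ ω, A.indicator (fun ω' => P.w ω' • (X ω' + Y ω')) ω =
      ∑ ω, A.indicator (fun ω' => P.w ω' • X ω') ω +
        ∑ ω, A.indicator (fun ω' => P.w ω' • Y ω') ω := by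
  rw [← Finset.sum_add_distrib]
  refine Finset.sum_congr rfl fun ω _ => ?_
  by_cases hω : ω ∈ A <;> simp [hω, mul_add]

end CondExp

namespace Market

variable {Ω : Type*} [Fintype Ω] {T d : ℕ} {M : Market Ω T d} {E : ℕ → Set Ω}

/-- There is a stopping time consistent with the policy `E` that exercises at `t` throughout `E t`
(and at the last permitted opportunity elsewhere). -/
theorem IsPolicy.exists_consStop (hE : M.IsPolicy E) {t : ℕ} (ht : t ≤ T) :
    ∃ τ : Ω → ℕ, M.ConsStop E τ ∧ ∀ ω ∈ E t, τ ω = t := by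
  classical
  have hlast : ∀ ω, ∃ s ≤ T, ω ∈ E s ∧ ∀ u, s < u → u ≤ T → ω ∉ E u := fun ω => by
    have hω : ω ∈ ⋃ t ∈ Finset.range (T + 1), E t := hE.2.2 ▸ Set.mem_univ ω
    simp only [Set.mem_iUnion, Finset.mem_range, exists_prop] at hω
    obtain ⟨s, hs, hsE⟩ := hω
    exact ⟨Nat.findGreatest (fun s => ω ∈ E s) T, Nat.findGreatest_le T,
      Nat.findGreatest_spec (P := fun s => ω ∈ E s) (Nat.lt_succ_iff.1 hs) hsE,
      fun u hu huT => Nat.findGreatest_is_greatest hu huT⟩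
  choose σ hσT hσE hσ using hlast
  have hset : ∀ s ≤ T, {ω | σ ω = s} = E s \ ⋃ u ∈ Finset.Icc (s + 1) T, E u := fun s hs => by
    ext ω
    simp only [Set.mem_ofPred_eq, Set.mem_sdiff, Set.mem_iUnion, Finset.mem_Icc, exists_prop,
      not_exists, not_and]
    constructor
    · rintro rfl
      exact ⟨hσE ω, fun u hu => hσ ω u hu.1 hu.2⟩
    · rintro ⟨h1, h2⟩
      rcases lt_trichotomy (σ ω) s with h | h | h
      · exact absurd h1 (hσ ω s h hs)
      · exact h
      · exact absurd (hσE ω) (h2 _ ⟨h, hσT ω⟩)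
  have hmeas : ∀ s, MeasurableSet[M.F s] {ω | σ ω = s} := fun s => by
    rcases lt_trichotomy s T with h | rfl | h
    · rw [hset s h.le]
      exact (hE.1 s h.le).diff (hE.2.1 s h)
    · rw [M.F_top]
      trivial
    · convert MeasurableSet.empty
      ext ω
      simpa using ((hσT ω).trans_lt h).ne
  refine ⟨fun ω => if ω ∈ E t then t else σ ω, ⟨⟨fun ω => ?_, fun s => ?_⟩, fun s ω hω => ?_⟩,
    fun ω hω => if_pos hω⟩
  · dsimp only
    split_ifs
    exacts [ht, hσT ω]
  · rcases lt_trichotomy s t with h | rfl | h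
    · convert hmeas s using 1
      ext ω
      by_cases hω : ω ∈ E t
      · have : σ ω ≠ s := fun hs => hσ ω t (hs ▸ h) ht hω
        simp [hω, this, h.ne']
      · simp [hω]
    · convert hE.1 s ht using 1
      ext ω
      by_cases hω : ω ∈ E s
      · simp [hω]
      · have : σ ω ≠ s := fun hs => hω (hs ▸ hσE ω)
        simp [hω, this]
    · convert (hmeas s).diff (M.F_mono t s h.le _ (hE.1 t ht)) using 1
      ext ω
      by_cases hω : ω ∈ E t <;> simp [hω, h.ne]
  · replace hω : (if ω ∈ E t then t else σ ω) = s := hω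
    split_ifs at hω with h
    · exact hω ▸ h
    · exact hω ▸ hσE ω

theorem SellerHedge.sub_mem_solvency {ξ y : ℕ → Ω → V d} (hy : M.SellerHedge E ξ y)
    (hE : M.IsPolicy E) {t : ℕ} (ht : t ≤ T) {ω : Ω} (hω : ω ∈ E t) :
    y t ω - ξ t ω ∈ M.solvency t ω := by
  obtain ⟨τ, hτ, hτt⟩ := hE.exists_consStop ht
  have h := hy.2 τ hτ ω
  rwa [hτt ω hω] at h

theorem SellerHedge.chi_mul_vdot_le {ξ y S : ℕ → Ω → V d} {χ : ℕ → Ω → ℝ}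
    (hy : M.SellerHedge E ξ y) (hE : M.IsPolicy E) (hχ : M.ConsRStop E χ) {t : ℕ} (ht : t ≤ T)
    (ω : Ω) (hS : S t ω ∈ M.dualCone t ω) :
    χ t ω * vdot (ξ t ω) (S t ω) ≤ χ t ω * vdot (y t ω) (S t ω) := by
  rcases (hχ.1.2.1 t ht ω).eq_or_lt with h | h
  · simp [← h]
  · refine mul_le_mul_of_nonneg_left ?_ h.le
    have := hS _ (hy.sub_mem_solvency hE ht (hχ.2 t ht h))
    rw [vdot_sub_right, vdot_comm, vdot_comm (S t ω)] at this
    linarith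

theorem schi_eq_add (χ : ℕ → Ω → ℝ) (S : ℕ → Ω → V d) {t : ℕ} (ht : t ≤ T) :
    M.schi χ S t = fun ω => χ t ω • S t ω + M.schi χ S (t + 1) ω := by
  funext ω
  simp only [schi]
  rw [← Finset.insert_Icc_add_one_left_eq_Icc ht, Finset.sum_insert (by simp)]

theorem SelfFinancing.measurable {y : ℕ → Ω → V d} (hy : M.SelfFinancing y) {t : ℕ}
    (ht : t ≤ T) : Measurable[M.F t] (y t) :=
  (hy.1 t ht).mono (M.F_mono _ _ (Nat.sub_le t 1)) le_rfl

/-- Integrated form of the hedging inequality over events of `F t`. -/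
theorem SellerHedge.sum_indicator_le {ξ y S : ℕ → Ω → V d} {χ : ℕ → Ω → ℝ} {P : Prob Ω}
    (hy : M.SellerHedge E ξ y) (hE : M.IsPolicy E) (hχ : M.ConsRStop E χ)
    (hPS : M.ApproxPair χ P S) {t : ℕ} (ht : t ≤ T) :
    ∀ A : Set Ω, MeasurableSet[M.F t] A →
      ∑ ω, A.indicator (fun ω' =>
          P.w ω' • ∑ u ∈ Finset.Icc t T, χ u ω' * vdot (ξ u ω') (S u ω')) ω ≤
        ∑ ω, A.indicator (fun ω' => P.w ω' • vdot (y t ω') (M.schi χ S t ω')) ω := by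
  induction ht using Nat.decreasingInduction with
  | self =>
    refine fun A _ => sum_indicator_weight_mono P A fun ω => ?_
    simpa [schi, vdot_smul_right] using
      hy.chi_mul_vdot_le hE hχ le_rfl ω (hPS.2.1 T le_rfl ω).1
  | of_succ t ht ih =>
    intro A hA
    obtain ⟨g, hg, hgd⟩ := hPS.2.2 t ht.le
    have hfuture : ∑ ω, A.indicator (fun ω' =>
          P.w ω' • ∑ u ∈ Finset.Icc (t + 1) T, χ u ω' * vdot (ξ u ω') (S u ω')) ω ≤
        ∑ ω, A.indicator (fun ω' => P.w ω' • vdot (y t ω') (M.schi χ S (t + 1) ω')) ω := by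
      refine (ih A (M.F_mono t (t + 1) t.le_succ _ hA)).trans ?_
      rw [← (hg.vdot_left (hy.1.1 (t + 1) ht)).2 A hA,
        ← (hg.vdot_left (hy.1.measurable ht.le)).2 A hA]
      refine sum_indicator_weight_mono P A fun ω => ?_
      have := hgd ω _ (hy.1.2 t ht ω)
      rw [vdot_sub_right, vdot_comm, vdot_comm (g ω)] at this
      linarith
    have hnow := sum_indicator_weight_mono P A fun ω =>
      hy.chi_mul_vdot_le hE hχ ht.le ω (hPS.2.1 t ht.le ω).1
    have hsplit : ∀ ω, ∑ u ∈ Finset.Icc t T, χ u ω * vdot (ξ u ω) (S u ω) =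
        χ t ω * vdot (ξ t ω) (S t ω) +
          ∑ u ∈ Finset.Icc (t + 1) T, χ u ω * vdot (ξ u ω) (S u ω) := fun ω => by
      rw [← Finset.insert_Icc_add_one_left_eq_Icc ht.le, Finset.sum_insert (by simp)]
    simp only [hsplit, schi_eq_add χ S ht.le, vdot_add_right, vdot_smul_right]
    rw [sum_indicator_weight_add, sum_indicator_weight_add]
    exact add_le_add hnow hfuture

end Market

/-- if `χ ∈ X^E`, `(P, S)` is a `χ`-approximate martingale pair and
`y ∈ Φ` superhedges `(ξ, E)` for the seller, then for every `t ≤ T` there are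
versions `g` of `E_P(S^{χ*}_t | F_t)` and `h` of `E_P((ξ·S)^{χ*}_t | F_t)` with
`h ≤ y_t · g` pointwise. -/
theorem statement17 {Ω : Type*} [Fintype Ω] [Nonempty Ω] {T d : ℕ}
    (M : Market Ω T d) (E : ℕ → Set Ω) (hE : M.IsPolicy E)
    (ξ : ℕ → Ω → V d) (hξ : M.Adapted ξ)
    (χ : ℕ → Ω → ℝ) (hχ : M.ConsRStop E χ)
    (P : Prob Ω) (S : ℕ → Ω → V d) (hPS : M.ApproxPair χ P S)
    (y : ℕ → Ω → V d) (hy : M.SellerHedge E ξ y) :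
    ∀ t, t ≤ T → ∃ (g : Ω → V d) (h : Ω → ℝ),
      IsCondExp P (M.F t) (M.schi χ S t) g ∧
      IsCondExp P (M.F t)
        (fun ω => ∑ u ∈ Finset.Icc t T, χ u ω * vdot (ξ u ω) (S u ω)) h ∧
      ∀ ω, h ω ≤ vdot (y t ω) (g ω) := by
  intro t ht
  obtain ⟨g, hg, -⟩ := hPS.2.2 t ht
  have hg' := hg.add_left (f := fun ω => χ t ω • S t ω) ((hχ.1.1 t ht).smul (hPS.1 t ht))
  rw [← Market.schi_eq_add χ S ht] at hg'
  obtain ⟨h, hh, hle⟩ := (hg'.vdot_left (hy.1.measurable ht)).exists_le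
    (hy.sum_indicator_le hE hχ hPS ht)
  exact ⟨_, h, hg', hh, hle⟩

end RZpaper
end
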